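/- Let M be a set and G a group acting on M on the right, and let g : M → G be such that σ_g is a bijection. Define h : M → G by h(y) = ( g(σ_g⁻¹(y)) )⁻¹. Then σ_h = σ_g⁻¹ (so h belongs to G^g_M) and h is a two-sided inverse of g for the multiplication (g * g')(x) = g(x) · g'(σ_g(x)): g * h = 1 and h * g = 1, where 1 is the constant identity function. Consequently G^g_M is a group. -/

import Mathlib

/-- The multiplication `(g * g')(x) = g(x) · g'(σ_g(x))` of the generalized gauge group
`G^g_M`, where `σ_g(x) = act x (g x)` (formulas (1),(2)). -/
def gaugeMul {M G : Type*} [Group G] (act : M → G → M) (g g' : M → G) : M → G :=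
  fun x => g x * g' (act x (g x))

/-- **Inverses in the generalized gauge group `G^g_M`.**  Let `G` act on a set `M` on the
right (`act x 1 = x`, `act x (a·b) = act (act x a) b`) and let `g : M → G` be such that
`σ_g(x) = act x (g x)` is a bijection.  Define `h(y) = (g(σ_g⁻¹(y)))⁻¹`.  Then
`σ_h = σ_g⁻¹` (so `h` belongs to `G^g_M`) and `h` is a two-sided inverse of `g` for the
multiplication `(g * g')(x) = g(x)·g'(σ_g(x))`: `g * h = 1` and `h * g = 1`.
Consequently `G^g_M` is a group. -/
theorem gaugeMul_inverse {M G : Type*} [Group G]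
    (act : M → G → M)
    (h1 : ∀ x : M, act x 1 = x)
    (hm : ∀ (x : M) (a b : G), act x (a * b) = act (act x a) b)
    (g : M → G) (hg : Function.Bijective fun x => act x (g x)) :
    ((fun y => act y ((g ((Equiv.ofBijective _ hg).symm y))⁻¹))
        = ⇑(Equiv.ofBijective _ hg).symm)
    ∧ gaugeMul act g (fun y => (g ((Equiv.ofBijective _ hg).symm y))⁻¹) = 1
    ∧ gaugeMul act (fun y => (g ((Equiv.ofBijective _ hg).symm y))⁻¹) g = 1 := by
  have hσ : ∀ y, act y (g ((Equiv.ofBijective _ hg).symm y))⁻¹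
      = (Equiv.ofBijective _ hg).symm y := fun y => by
    obtain ⟨x, rfl⟩ := (Equiv.ofBijective _ hg).surjective y
    rw [Equiv.symm_apply_apply, Equiv.ofBijective_apply, ← hm, mul_inv_cancel, h1]
  refine ⟨funext hσ, funext fun x => ?_, funext fun y => ?_⟩
  · have hx : (Equiv.ofBijective _ hg).symm (act x (g x)) = x :=
      (Equiv.ofBijective _ hg).symm_apply_apply x
    simp only [gaugeMul, hx, mul_inv_cancel, Pi.one_apply]
  · simp only [gaugeMul, hσ, inv_mul_cancel, Pi.one_apply]
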